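/- Let p be an odd prime and let h be a vanishing sorou whose relative order divides 2p. Then h can be written as a multiset sum h = v_1 + v_2 + ⋯ + v_k where each v_i is either of the form {z, −z} for some root of unity z, or of the form {z, zν_p, zν_p^2, …, zν_p^{p−1}} for some root of unity z. -/

import Mathlib

open Complex

noncomputable def nu (n : ℕ) : ℂ := Complex.exp (2 * Real.pi * Complex.I / n)

def IsRootOfUnity (z : ℂ) : Prop := ∃ n : ℕ, 0 < n ∧ z ^ n = 1

def IsSorou (h : Multiset ℂ) : Prop := h ≠ 0 ∧ ∀ z ∈ h, IsRootOfUnity z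

noncomputable def rootOrder (z : ℂ) : ℕ := sInf {d : ℕ | 0 < d ∧ z ^ d = 1}

noncomputable def sorouOrder (h : Multiset ℂ) : ℕ := (h.map rootOrder).lcm

noncomputable def relOrder (h : Multiset ℂ) : ℕ :=
  (h.bind fun a => h.map fun b => rootOrder (a / b)).lcm

def IsMinVanishing (h : Multiset ℂ) : Prop :=
  h.sum = 0 ∧ ∀ g : Multiset ℂ, g ≤ h → g ≠ 0 → g ≠ h → g.sum ≠ 0

theorem IsRootOfUnity.ne_zero {z : ℂ} (hz : IsRootOfUnity z) : z ≠ 0 := by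
  obtain ⟨n, hn, h⟩ := hz
  rintro rfl
  simp [hn.ne'] at h

theorem IsRootOfUnity.div {a b : ℂ} (ha : IsRootOfUnity a) (hb : IsRootOfUnity b) :
    IsRootOfUnity (a / b) := by
  obtain ⟨m, hm, ha⟩ := ha
  obtain ⟨n, hn, hb⟩ := hb
  refine ⟨m * n, Nat.mul_pos hm hn, ?_⟩
  rw [div_pow, pow_mul, ha, mul_comm m n, pow_mul, hb]
  simp

theorem IsRootOfUnity.pow_rootOrder {z : ℂ} (hz : IsRootOfUnity z) : z ^ rootOrder z = 1 :=
  (Nat.sInf_mem (s := {d : ℕ | 0 < d ∧ z ^ d = 1}) hz).2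

theorem IsSorou.div_pow_eq_one {h : Multiset ℂ} (hs : IsSorou h) {n : ℕ} (hn : relOrder h ∣ n)
    {a b : ℂ} (ha : a ∈ h) (hb : b ∈ h) : (a / b) ^ n = 1 := by
  have hdvd : rootOrder (a / b) ∣ n := by
    refine dvd_trans (Multiset.dvd_lcm ?_) hn
    exact Multiset.mem_bind.2 ⟨a, ha, Multiset.mem_map.2 ⟨b, hb, rfl⟩⟩
  obtain ⟨k, rfl⟩ := hdvd
  rw [pow_mul, ((hs.2 a ha).div (hs.2 b hb)).pow_rootOrder, one_pow]

theorem isPrimitiveRoot_nu {n : ℕ} (hn : n ≠ 0) : IsPrimitiveRoot (nu n) n :=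
  Complex.isPrimitiveRoot_exp n hn

theorem IsPrimitiveRoot.eq_pow_or_eq_neg_pow {p : ℕ} (hodd : Odd p) {ζ x : ℂ}
    (hζ : IsPrimitiveRoot ζ p) (hx : x ^ (2 * p) = 1) :
    ∃ j : Fin p, x = ζ ^ j.val ∨ x = -ζ ^ j.val := by
  have : NeZero p := ⟨hodd.pos.ne'⟩
  rw [mul_comm, pow_mul, sq_eq_one_iff] at hx
  rcases hx with hx | hx
  · obtain ⟨i, hi, h⟩ := hζ.eq_pow_of_pow_eq_one hx
    exact ⟨⟨i, hi⟩, Or.inl h.symm⟩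
  · have hx' : (-x) ^ p = 1 := by rw [hodd.neg_pow, hx, neg_neg]
    obtain ⟨i, hi, h⟩ := hζ.eq_pow_of_pow_eq_one hx'
    exact ⟨⟨i, hi⟩, Or.inr (by simp [h])⟩

theorem IsPrimitiveRoot.pow_ne_neg_pow {p : ℕ} (hodd : Odd p) {ζ : ℂ}
    (hζ : IsPrimitiveRoot ζ p) (i j : ℕ) : ζ ^ i ≠ -ζ ^ j := by
  intro h
  have h' := congrArg (· ^ p) h
  simp only [hodd.neg_pow, ← pow_mul, mul_comm _ p] at h'
  simp only [pow_mul, hζ.pow_eq_one, one_pow] at h'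
  norm_num at h'

/-- The value of a multiset of `2p`-th roots of unity (up to a common factor `z`), expressed
through the signed multiplicities of its elements. -/
theorem Multiset.sum_eq_mul_sum_count_sub_count {p : ℕ} (hodd : Odd p) {ζ z : ℂ}
    (hζ : IsPrimitiveRoot ζ p) (hz : z ≠ 0) (g : Multiset ℂ)
    (hg : ∀ w ∈ g, (w / z) ^ (2 * p) = 1) :
    g.sum = z * ∑ i : Fin p,
      (((g.count (z * ζ ^ i.val) : ℤ) - (g.count (-(z * ζ ^ i.val)) : ℤ) : ℤ) : ℂ) *
        ζ ^ i.val := by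
  induction g using Multiset.induction_on with
  | empty => simp
  | cons w g ih =>
    have ih := ih fun w hw => hg w (Multiset.mem_cons_of_mem hw)
    have hinj (i j : Fin p) : ζ ^ i.val = ζ ^ j.val ↔ i = j :=
      ⟨fun h => Fin.ext (hζ.pow_inj i.2 j.2 h), fun h => h ▸ rfl⟩
    have hne (i j : Fin p) : ¬ -ζ ^ i.val = ζ ^ j.val :=
      fun h => hζ.pow_ne_neg_pow hodd j i h.symm
    have hne' (i j : Fin p) : ¬ ζ ^ i.val = -ζ ^ j.val := hζ.pow_ne_neg_pow hodd i j
    obtain ⟨j, hj⟩ := hζ.eq_pow_or_eq_neg_pow hodd (hg w (Multiset.mem_cons_self w g))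
    rw [Multiset.sum_cons, ih]
    rcases hj with hj | hj <;> rw [div_eq_iff hz, mul_comm] at hj <;> subst hj <;>
      simp only [Multiset.count_cons, ← mul_neg, mul_right_inj' hz, neg_inj, hinj, hne, hne',
        if_false, Nat.cast_add, Nat.cast_ite, Nat.cast_zero, Nat.cast_one, add_zero,
        Int.cast_sub, Int.cast_add, Int.cast_ite, Int.cast_zero, Int.cast_one, Int.cast_natCast,
        sub_mul, add_mul, ite_mul, one_mul, zero_mul, Finset.sum_sub_distrib,
        Finset.sum_add_distrib, Finset.sum_ite_eq', Finset.mem_univ, if_true] <;> ring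

/-- A nonempty vanishing multiset whose ratios are `2p`-th roots of unity contains an antipodal
pair or a full rotated set of `p`-th roots of unity. -/
theorem exists_pair_or_orbit_le {p : ℕ} (hp : p.Prime) (hodd : Odd p) {h : Multiset ℂ}
    {z : ℂ} (hz : z ∈ h) (h0 : ∀ w ∈ h, w ≠ 0) (hvan : h.sum = 0)
    (hratio : ∀ a ∈ h, ∀ b ∈ h, (a / b) ^ (2 * p) = 1) :
    ({z, -z} : Multiset ℂ) ≤ h ∨ (Multiset.range p).map (fun j => z * nu p ^ j) ≤ h := by
  have hz0 := h0 z hz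
  have hζ := isPrimitiveRoot_nu hp.ne_zero
  by_cases hneg : -z ∈ h
  · left
    rw [Multiset.le_iff_subset (by simpa using self_ne_neg.2 hz0)]
    intro w hw
    simp only [Multiset.insert_eq_cons, Multiset.mem_cons, Multiset.mem_singleton] at hw
    rcases hw with rfl | rfl <;> assumption
  · right
    have hsum := Multiset.sum_eq_mul_sum_count_sub_count hodd hζ hz0 h
      fun w hw => hratio w hw z hz
    rw [hvan, eq_comm, mul_eq_zero, or_iff_right hz0,
      hζ.sum_eq_zero_iff_forall_eq_int hp] at hsum
    rw [Multiset.le_iff_subset]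
    · intro w hw
      obtain ⟨i, hi, rfl⟩ := Multiset.mem_map.1 hw
      have heq := hsum ⟨i, Multiset.mem_range.1 hi⟩ ⟨0, hp.pos⟩
      simp only [pow_zero, mul_one, Multiset.count_eq_zero_of_notMem hneg] at heq
      have hpos := Multiset.count_pos.2 hz
      exact Multiset.count_pos.1 (by omega)
    · refine Multiset.Nodup.map_on ?_ (Multiset.nodup_range p)
      intro i hi j hj hij
      exact hζ.pow_inj (Multiset.mem_range.1 hi) (Multiset.mem_range.1 hj)
        (mul_left_cancel₀ hz0 hij)

theorem sum_map_mul_nu_pow_eq_zero {p : ℕ} (hp : 1 < p) (z : ℂ) :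
    ((Multiset.range p).map fun j => z * nu p ^ j).sum = 0 := by
  rw [Multiset.sum_map_mul_left]
  have := (isPrimitiveRoot_nu (by omega : p ≠ 0)).geom_sum_eq_zero hp
  exact mul_eq_zero_of_right z this

theorem exists_decomposition_of_sum_eq_zero {p : ℕ} (hp : p.Prime) (hodd : Odd p)
    (h : Multiset ℂ) (hroot : ∀ w ∈ h, IsRootOfUnity w) (hvan : h.sum = 0)
    (hratio : ∀ a ∈ h, ∀ b ∈ h, (a / b) ^ (2 * p) = 1) :
    ∃ V : Multiset (Multiset ℂ), h = V.sum ∧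
      ∀ v ∈ V,
        (∃ z : ℂ, IsRootOfUnity z ∧ v = ({z, -z} : Multiset ℂ)) ∨
        (∃ z : ℂ, IsRootOfUnity z ∧ v = (Multiset.range p).map (fun j => z * nu p ^ j)) := by
  induction h using Multiset.strongInductionOn with
  | ih h ih =>
    rcases h.empty_or_exists_mem with rfl | ⟨z, hz⟩
    · exact ⟨0, by simp⟩
    have hpiece : ∃ v ≤ h, v ≠ 0 ∧ v.sum = 0 ∧
        ((∃ z : ℂ, IsRootOfUnity z ∧ v = ({z, -z} : Multiset ℂ)) ∨
        (∃ z : ℂ, IsRootOfUnity z ∧ v = (Multiset.range p).map (fun j => z * nu p ^ j))) := by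
      rcases exists_pair_or_orbit_le hp hodd hz (fun w hw => (hroot w hw).ne_zero) hvan hratio
        with hle | hle
      · exact ⟨_, hle, by simp, by simp, Or.inl ⟨z, hroot z hz, rfl⟩⟩
      · refine ⟨_, hle, ?_, sum_map_mul_nu_pow_eq_zero hp.one_lt z,
          Or.inr ⟨z, hroot z hz, rfl⟩⟩
        rw [← Multiset.card_pos]
        simpa using hp.pos
    obtain ⟨v, hle, hv0, hvsum, hv⟩ := hpiece
    obtain ⟨g, rfl⟩ := Multiset.le_iff_exists_add.1 hle
    have hmem : ∀ w ∈ g, w ∈ v + g := fun w hw => Multiset.mem_add.2 (Or.inr hw)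
    obtain ⟨V, rfl, hV⟩ := ih g (lt_add_of_pos_left g (pos_iff_ne_zero.2 hv0))
      (fun w hw => hroot w (hmem w hw)) (by simpa [hvsum] using hvan)
      (fun a ha b hb => hratio a (hmem a ha) b (hmem b hb))
    refine ⟨v ::ₘ V, by simp, fun u hu => ?_⟩
    rcases Multiset.mem_cons.1 hu with rfl | hu
    exacts [hv, hV u hu]

theorem stmt_6 (p : ℕ) (hp : p.Prime) (hodd : Odd p)
    (h : Multiset ℂ) (hs : IsSorou h) (hvan : h.sum = 0)
    (hdvd : relOrder h ∣ 2 * p) :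
    ∃ V : Multiset (Multiset ℂ), h = V.sum ∧
      ∀ v ∈ V,
        (∃ z : ℂ, IsRootOfUnity z ∧ v = ({z, -z} : Multiset ℂ)) ∨
        (∃ z : ℂ, IsRootOfUnity z ∧ v = (Multiset.range p).map (fun j => z * nu p ^ j)) := by
  exact exists_decomposition_of_sum_eq_zero hp hodd h hs.2 hvan
    fun _ ha _ hb => hs.div_pow_eq_one hdvd ha hb
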